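/- arXiv:1304.7033 — 2 statements merged into one kernel-verified Lean document; each statement's English description precedes it below -/
import Mathlib

section
/- Let n ≥ 1 and p ≥ 1. If |p − 4| < 4·log(1 + 2/n)/log(n+2), then the largest cardinality of an equilateral set in ℓ_p^n is exactly n+1, i.e. e(ℓ_p^n) = n+1. -/
open Finset

/-- The p-norm on `ℝ^n`. -/
noncomputable def pnorm (p : ℝ) {n : ℕ} (x : Fin n → ℝ) : ℝ :=
  (∑ i, |x i| ^ p) ^ (1 / p)

/-- A set `S ⊆ ℝ^n` is equilateral with respect to the p-norm if there is `λ > 0`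
with `‖x - y‖_p = λ` for all distinct `x, y ∈ S`. -/
def IsEquilateral (p : ℝ) {n : ℕ} (S : Set (Fin n → ℝ)) : Prop :=
  ∃ lam > 0, ∀ x ∈ S, ∀ y ∈ S, x ≠ y → pnorm p (x - y) = lam

/-- The quartic form of a weight with vanishing zeroth and first moments is nonnegative. -/
lemma quartic_energy_nonneg {n : ℕ} (t : Finset (Fin n → ℝ)) (c : (Fin n → ℝ) → ℝ)
    (h0 : ∑ x ∈ t, c x = 0) (h1 : ∀ i, ∑ x ∈ t, c x * x i = 0) :
    0 ≤ ∑ x ∈ t, ∑ y ∈ t, c x * c y * ∑ i, (x i - y i) ^ 4 := by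
  have key : ∑ x ∈ t, ∑ y ∈ t, c x * c y * ∑ i, (x i - y i) ^ 4
      = ∑ i, 6 * (∑ x ∈ t, c x * x i ^ 2) ^ 2 := by
    simp_rw [Finset.mul_sum]
    rw [Finset.sum_congr rfl fun x _ => Finset.sum_comm, Finset.sum_comm]
    refine Finset.sum_congr rfl fun i _ => ?_
    have hx : ∀ x ∈ t, ∑ y ∈ t, c x * c y * (x i - y i) ^ 4
        = c x * ∑ y ∈ t, c y * y i ^ 4 - 4 * (c x * x i) * ∑ y ∈ t, c y * y i ^ 3
          + 6 * (c x * x i ^ 2) * ∑ y ∈ t, c y * y i ^ 2 := by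
      intro x _
      have : ∑ y ∈ t, c x * c y * (x i - y i) ^ 4
          = c x * x i ^ 4 * ∑ y ∈ t, c y - 4 * (c x * x i ^ 3) * ∑ y ∈ t, c y * y i
            + (c x * ∑ y ∈ t, c y * y i ^ 4 - 4 * (c x * x i) * ∑ y ∈ t, c y * y i ^ 3
            + 6 * (c x * x i ^ 2) * ∑ y ∈ t, c y * y i ^ 2) := by
        simp only [Finset.mul_sum, ← Finset.sum_add_distrib, ← Finset.sum_sub_distrib]
        exact Finset.sum_congr rfl fun y _ => by ring
      rw [this, h0, h1 i]
      ring
    rw [Finset.sum_congr rfl hx, Finset.sum_add_distrib, Finset.sum_sub_distrib,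
      ← Finset.sum_mul, ← Finset.sum_mul, ← Finset.sum_mul, ← Finset.mul_sum, ← Finset.mul_sum,
      h0, h1 i]
    ring
  rw [key]
  positivity

/-- A set of points in `ℝ^n` whose fourth-power distances are nearly equal has at most `n + 1`
elements. -/
lemma card_ne_of_quartic_dist_mem_Icc {n : ℕ} (t : Finset (Fin n → ℝ)) {α β : ℝ}
    (hαβ : n * β < (n + 2) * α)
    (hα : ∀ x ∈ t, ∀ y ∈ t, x ≠ y → α ≤ ∑ i, (x i - y i) ^ 4)
    (hβ : ∀ x ∈ t, ∀ y ∈ t, x ≠ y → ∑ i, (x i - y i) ^ 4 ≤ β) : t.card ≠ n + 2 := by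
  intro ht
  obtain ⟨c, hc1, hc0, z, hz, hcz⟩ :=
    Module.exists_nontrivial_relation_sum_zero_of_finrank_succ_lt_card (R := ℝ) (t := t)
      (by simp [ht])
  have h1 : ∀ i, ∑ x ∈ t, c x * x i = 0 := fun i => by
    simpa using congrFun hc1 i
  have hnonneg := quartic_energy_nonneg t c hc0 h1
  have hterm : ∀ x ∈ t, ∀ y ∈ t, c x * c y * ∑ i, (x i - y i) ^ 4
      ≤ (α + β) / 2 * (c x * c y) + (β - α) / 2 * (|c x| * |c y|)
        - (if x = y then β * c x ^ 2 else 0) := by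
    intro x hx y hy
    split_ifs with hxy
    · subst hxy
      simp only [sub_self, ne_eq, OfNat.ofNat_ne_zero, not_false_eq_true, zero_pow,
        Finset.sum_const_zero, mul_zero, abs_mul_abs_self]
      exact le_of_eq (by ring)
    · have hs : |∑ i, (x i - y i) ^ 4 - (α + β) / 2| ≤ (β - α) / 2 :=
        abs_le.2 ⟨by linarith [hα x hx y hy hxy], by linarith [hβ x hx y hy hxy]⟩
      have hm := mul_le_mul_of_nonneg_left hs (abs_nonneg (c x * c y))
      rw [← abs_mul] at hm
      have := (le_abs_self _).trans hm
      rw [abs_mul (c x)] at this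
      linarith
  have hsum : ∑ x ∈ t, ∑ y ∈ t, c x * c y * ∑ i, (x i - y i) ^ 4
      ≤ (β - α) / 2 * (∑ x ∈ t, |c x|) ^ 2 - β * ∑ x ∈ t, c x ^ 2 := by
    refine (Finset.sum_le_sum fun x hx => Finset.sum_le_sum fun y hy =>
      hterm x hx y hy).trans (le_of_eq ?_)
    simp only [Finset.sum_sub_distrib, Finset.sum_add_distrib, ← Finset.mul_sum, hc0]
    simp only [Finset.sum_ite_eq, mul_zero, Finset.sum_const_zero, zero_add, ← Finset.sum_mul]
    rw [Finset.sum_congr rfl fun x hx => if_pos hx, ← Finset.mul_sum]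
    ring
  have hcs : (∑ x ∈ t, |c x|) ^ 2 ≤ (n + 2) * ∑ x ∈ t, c x ^ 2 := by
    have := sq_sum_le_card_mul_sum_sq (s := t) (f := fun x => |c x|)
    simpa [ht] using this
  have hpos : 0 < ∑ x ∈ t, c x ^ 2 :=
    Finset.sum_pos' (fun x _ => sq_nonneg _) ⟨z, hz, by positivity⟩
  have hle : α ≤ β := by
    obtain ⟨x, hx, y, hy, hxy⟩ := Finset.one_lt_card.1 (by omega : 1 < t.card)
    exact (hα x hx y hy hxy).trans (hβ x hx y hy hxy)
  nlinarith [mul_le_mul_of_nonneg_left hcs (by linarith : 0 ≤ (β - α) / 2),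
    mul_pos (sub_pos.2 hαβ) hpos]

lemma sum_rpow_le_rpow_sum {ι : Type*} (s : Finset ι) (f : ι → ℝ) (hf : ∀ i, 0 ≤ f i) {r : ℝ}
    (hr : 1 ≤ r) : ∑ i ∈ s, f i ^ r ≤ (∑ i ∈ s, f i) ^ r := by
  classical
  induction s using Finset.induction_on with
  | empty => simp [Real.zero_rpow (by linarith : r ≠ 0)]
  | insert a s ha ih =>
    rw [Finset.sum_insert ha, Finset.sum_insert ha]
    exact (add_le_add_right ih _).trans
      (Real.add_rpow_le_rpow_add (hf a) (Finset.sum_nonneg fun i _ => hf i) hr)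

lemma rpow_sum_le_card_mul_sum_rpow {n : ℕ} (f : Fin n → ℝ) (hf : ∀ i, 0 ≤ f i) {r : ℝ}
    (hr : 1 ≤ r) : (∑ i, f i) ^ r ≤ (n : ℝ) ^ (r - 1) * ∑ i, f i ^ r := by
  simpa [abs_of_nonneg (hf _)] using Real.rpow_sum_le_const_mul_sum_rpow Finset.univ f hr

/-- Comparison of the `p`-norm and the `4`-norm for `p ≤ 4`. -/
lemma quartic_bounds_of_le_four {n : ℕ} {p : ℝ} (hp : 0 < p) (hp4 : p ≤ 4) (z : Fin n → ℝ) :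
    pnorm p z ^ 4 ≤ (n : ℝ) ^ (4 / p - 1) * ∑ i, z i ^ 4 ∧ ∑ i, z i ^ 4 ≤ pnorm p z ^ 4 := by
  have hr : 1 ≤ 4 / p := by rwa [one_le_div hp]
  have hf : ∀ i, 0 ≤ |z i| ^ p := fun i => by positivity
  have hz : ∀ i, (|z i| ^ p) ^ (4 / p) = z i ^ 4 := fun i => by
    rw [← Real.rpow_mul (abs_nonneg _), mul_div_cancel₀ _ hp.ne']
    exact_mod_cast Even.pow_abs (by decide) (z i)
  have hN : pnorm p z ^ 4 = (∑ i, |z i| ^ p) ^ (4 / p) := by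
    rw [pnorm, ← Real.rpow_natCast, ← Real.rpow_mul (Finset.sum_nonneg fun i _ => hf i)]
    congr 1
    push_cast
    ring
  have h1 := rpow_sum_le_card_mul_sum_rpow _ hf hr
  have h2 := sum_rpow_le_rpow_sum Finset.univ _ hf hr
  simp only [hz] at h1 h2
  rw [hN]
  exact ⟨h1, h2⟩

/-- Comparison of the `p`-norm and the `4`-norm for `p ≥ 4`. -/
lemma quartic_bounds_of_four_le {n : ℕ} {p : ℝ} (hp4 : 4 ≤ p) (z : Fin n → ℝ) :
    pnorm p z ^ 4 ≤ ∑ i, z i ^ 4 ∧ ∑ i, z i ^ 4 ≤ (n : ℝ) ^ (1 - 4 / p) * pnorm p z ^ 4 := by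
  have hp : 0 < p := by linarith
  have hr : 1 ≤ p / 4 := by linarith
  have hf : ∀ i, 0 ≤ z i ^ 4 := fun i => by positivity
  have hz : ∀ i, (z i ^ 4) ^ (p / 4) = |z i| ^ p := fun i => by
    rw [← Even.pow_abs (by decide) (z i), ← Real.rpow_natCast, ← Real.rpow_mul (abs_nonneg _)]
    congr 1
    push_cast
    ring
  have hS : 0 ≤ ∑ i, |z i| ^ p := by positivity
  have hQ : 0 ≤ ∑ i, z i ^ 4 := by positivity
  have hN : pnorm p z ^ 4 = (∑ i, |z i| ^ p) ^ (4 / p) := by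
    rw [pnorm, ← Real.rpow_natCast, ← Real.rpow_mul hS]
    congr 1
    push_cast
    ring
  have hQr : ((∑ i, z i ^ 4) ^ (p / 4)) ^ (4 / p) = ∑ i, z i ^ 4 := by
    rw [← Real.rpow_mul hQ, show p / 4 * (4 / p) = 1 by field_simp, Real.rpow_one]
  have h1 := rpow_sum_le_card_mul_sum_rpow _ hf hr
  have h2 := sum_rpow_le_rpow_sum Finset.univ _ hf hr
  simp only [hz] at h1 h2
  have h4p : 0 ≤ 4 / p := by positivity
  rw [hN]
  constructor
  · exact (Real.rpow_le_rpow hS h2 h4p).trans hQr.le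
  · refine (hQr.ge.trans (Real.rpow_le_rpow (by positivity) h1 h4p)).trans_eq ?_
    rw [Real.mul_rpow (by positivity) hS, ← Real.rpow_mul (by positivity)]
    congr 2
    field_simp

/-- The hypothesis on `p` bounds the distortion between the `p`-norm and the `4`-norm. -/
lemma rpow_mul_lt_add_two {n : ℕ} (hn : 1 ≤ n) {p : ℝ} (hp : 0 < p)
    (h : |p - 4| < 4 * Real.log (1 + 2 / (n : ℝ)) / Real.log ((n : ℝ) + 2)) :
    (n : ℝ) ^ |1 - 4 / p| * n < n + 2 := by
  have hn' : (1 : ℝ) ≤ n := by exact_mod_cast hn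
  have hn0 : (0 : ℝ) < n := by linarith
  have hlogn : 0 ≤ Real.log n := Real.log_nonneg hn'
  have hL : Real.log (1 + 2 / (n : ℝ)) = Real.log (n + 2) - Real.log n := by
    rw [← Real.log_div (by positivity) (by positivity)]
    congr 1
    field_simp
  have hpos : 0 < Real.log ((n : ℝ) + 2) := Real.log_pos (by linarith)
  have hlt : Real.log n < Real.log ((n : ℝ) + 2) := Real.log_lt_log hn0 (by linarith)
  rw [lt_div_iff₀ hpos, hL] at h
  have hd : |1 - 4 / p| = |p - 4| / p := by
    rw [show 1 - 4 / p = (p - 4) / p by field_simp, abs_div, abs_of_pos hp]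
  have key : |p - 4| * Real.log n < p * (Real.log (n + 2) - Real.log n) := by
    rcases le_total p 4 with h4 | h4
    · rw [abs_of_nonpos (by linarith)] at h ⊢
      nlinarith
    · rw [abs_of_nonneg (by linarith)] at h ⊢
      nlinarith
  have : |1 - 4 / p| * Real.log n < Real.log (n + 2) - Real.log n := by
    rw [hd, div_mul_eq_mul_div, div_lt_iff₀ hp]
    linarith
  rw [← Real.log_lt_log_iff (by positivity) (by positivity),
    Real.log_mul (by positivity) (by positivity), Real.log_rpow hn0]
  linarith

lemma IsEquilateral.mono {p : ℝ} {n : ℕ} {S T : Set (Fin n → ℝ)} (hS : IsEquilateral p S)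
    (hT : T ⊆ S) : IsEquilateral p T := by
  obtain ⟨l, hl, h⟩ := hS
  exact ⟨l, hl, fun x hx y hy => h x (hT hx) y (hT hy)⟩

lemma IsEquilateral.card_ne {n : ℕ} (hn : 1 ≤ n) {p : ℝ} (hp : 0 < p)
    (h : |p - 4| < 4 * Real.log (1 + 2 / (n : ℝ)) / Real.log ((n : ℝ) + 2))
    (t : Finset (Fin n → ℝ)) (ht : IsEquilateral p (t : Set (Fin n → ℝ))) :
    t.card ≠ n + 2 := by
  obtain ⟨l, hl, hS⟩ := ht
  have hd := rpow_mul_lt_add_two hn hp h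
  have hn0 : (0 : ℝ) < n := by exact_mod_cast hn
  have hl4 : 0 < l ^ 4 := by positivity
  rcases le_total p 4 with h4 | h4
  · rw [abs_of_nonpos (by rw [sub_nonpos, one_le_div hp]; exact h4), neg_sub] at hd
    have hK : 0 < (n : ℝ) ^ (4 / p - 1) := by positivity
    refine card_ne_of_quartic_dist_mem_Icc t (α := l ^ 4 / (n : ℝ) ^ (4 / p - 1)) (β := l ^ 4)
      ?_ ?_ ?_
    · rw [← mul_div_assoc, lt_div_iff₀ hK]
      nlinarith [mul_lt_mul_of_pos_right hd hl4]
    · intro x hx y hy hxy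
      rw [div_le_iff₀' hK, ← hS x hx y hy hxy]
      exact (quartic_bounds_of_le_four hp h4 (x - y)).1
    · intro x hx y hy hxy
      rw [← hS x hx y hy hxy]
      exact (quartic_bounds_of_le_four hp h4 (x - y)).2
  · rw [abs_of_nonneg (by rw [sub_nonneg, div_le_one hp]; exact h4)] at hd
    refine card_ne_of_quartic_dist_mem_Icc t (α := l ^ 4) (β := (n : ℝ) ^ (1 - 4 / p) * l ^ 4)
      ?_ ?_ ?_
    · nlinarith [mul_lt_mul_of_pos_right hd hl4]
    · intro x hx y hy hxy
      rw [← hS x hx y hy hxy]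
      exact (quartic_bounds_of_four_le h4 (x - y)).1
    · intro x hx y hy hxy
      rw [← hS x hx y hy hxy]
      exact (quartic_bounds_of_four_le h4 (x - y)).2

lemma pnorm_neg (p : ℝ) {n : ℕ} (x : Fin n → ℝ) : pnorm p (-x) = pnorm p x := by
  simp [pnorm]

/-- The standard basis together with a multiple of the all-ones vector is equilateral. -/
lemma exists_isEquilateral_ncard (n : ℕ) (hn : 1 ≤ n) {p : ℝ} (hp : 1 ≤ p) :
    ∃ S : Set (Fin n → ℝ), S.Finite ∧ S.ncard = n + 1 ∧ IsEquilateral p S := by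
  have hp0 : p ≠ 0 := by linarith
  have hn' : (1 : ℝ) ≤ n := by exact_mod_cast hn
  obtain ⟨t, ht⟩ : ∃ t : ℝ, |t - 1| ^ p + (n - 1) * |t| ^ p = 2 := by
    have hc : ContinuousOn (fun t : ℝ => |t - 1| ^ p + (n - 1) * |t| ^ p) (Set.Icc 0 3) := by
      have : ∀ f : ℝ → ℝ, Continuous f → Continuous fun t => f t ^ p := fun f hf =>
        hf.rpow_const fun _ => Or.inr (by linarith)
      exact ((this _ (by fun_prop)).add (continuous_const.mul (this _ (by fun_prop)))).continuousOn
    have h2 : (2 : ℝ) ≤ 2 ^ p := by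
      simpa using Real.rpow_le_rpow_of_exponent_le (by norm_num : (1 : ℝ) ≤ 2) hp
    have h3 : 0 ≤ ((n : ℝ) - 1) * 3 ^ p := mul_nonneg (by linarith) (by positivity)
    obtain ⟨t, -, ht⟩ := intermediate_value_Icc (by norm_num) hc
      (show (2 : ℝ) ∈ _ from ⟨by norm_num [Real.zero_rpow hp0], by norm_num; linarith⟩)
    exact ⟨t, ht⟩
  let v : Option (Fin n) → Fin n → ℝ := fun o => o.elim (fun _ => t) fun i => Pi.single i 1
  have hsome : ∀ i j : Fin n, i ≠ j → pnorm p (v (some i) - v (some j)) = 2 ^ (1 / p) := by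
    intro i j hij
    have : ∀ k, |(v (some i) - v (some j)) k| ^ p
        = (if k = i then 1 else 0) + (if k = j then 1 else 0) := by
      intro k
      by_cases hi : k = i
      · subst hi
        simp [v, hij]
      · by_cases hj : k = j
        · subst hj
          simp [v, hi]
        · simp [v, hi, hj, Real.zero_rpow hp0]
    simp only [pnorm, this, Finset.sum_add_distrib, Finset.sum_ite_eq', Finset.mem_univ, if_true]
    norm_num
  have hnone : ∀ j : Fin n, pnorm p (v none - v (some j)) = 2 ^ (1 / p) := by
    intro j
    have : ∀ k, |(v none - v (some j)) k| ^ p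
        = |t| ^ p + (if k = j then |t - 1| ^ p - |t| ^ p else 0) := by
      intro k
      by_cases hj : k = j
      · subst hj
        simp [v]
      · simp [v, hj]
    simp only [pnorm, this, Finset.sum_add_distrib, Finset.sum_ite_eq', Finset.mem_univ, if_true,
      Finset.sum_const, Finset.card_univ, Fintype.card_fin, nsmul_eq_mul]
    congr 1
    linarith
  have hv : ∀ a b, a ≠ b → pnorm p (v a - v b) = 2 ^ (1 / p) := by
    rintro (_ | i) (_ | j) hab
    · exact absurd rfl hab
    · exact hnone j
    · rw [← neg_sub, pnorm_neg]
      exact hnone i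
    · exact hsome i j fun hij => hab (by rw [hij])
  have hinj : Function.Injective v := by
    intro a b hab
    by_contra hne
    have h := hv a b hne
    have h2 : (0 : ℝ) < 2 ^ (1 / p) := by positivity
    rw [hab, sub_self, pnorm] at h
    simp [Real.zero_rpow hp0] at h
    simp [Real.zero_rpow (inv_ne_zero hp0)] at h
    simp [← h] at h2
  refine ⟨Set.range v, Set.finite_range v, ?_, 2 ^ (1 / p), by positivity, ?_⟩
  · rw [← Set.image_univ, Set.ncard_image_of_injective _ hinj, Set.ncard_univ]
    simp
  · rintro _ ⟨a, rfl⟩ _ ⟨b, rfl⟩ hab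
    exact hv a b fun h => hab (by rw [h])

/-- **Corollary.** If `|p - 4| < 4 log(1 + 2/n) / log(n+2)` then the largest cardinality
of an equilateral set in `ℓ_p^n` is exactly `n + 1`. -/
theorem stmt1 (n : ℕ) (hn : 1 ≤ n) (p : ℝ) (hp : 1 ≤ p)
    (h : |p - 4| < 4 * Real.log (1 + 2 / (n : ℝ)) / Real.log ((n : ℝ) + 2)) :
    (∃ S : Set (Fin n → ℝ), S.Finite ∧ S.ncard = n + 1 ∧ IsEquilateral p S) ∧
    (∀ S : Set (Fin n → ℝ), IsEquilateral p S → S.Finite ∧ S.ncard ≤ n + 1) := by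
  refine ⟨exists_isEquilateral_ncard n hn hp, fun S hS => ?_⟩
  have hno : ∀ t : Finset (Fin n → ℝ), (t : Set (Fin n → ℝ)) ⊆ S → t.card ≠ n + 2 := fun t ht =>
    (hS.mono ht).card_ne hn (by linarith) h t
  have hfin : S.Finite := by
    by_contra hinf
    obtain ⟨t, hts, htc⟩ := Set.Infinite.exists_subset_card_eq hinf (n + 2)
    exact hno t hts htc
  refine ⟨hfin, ?_⟩
  by_contra! hlt
  rw [Set.ncard_eq_toFinset_card S hfin] at hlt
  obtain ⟨t, hts, htc⟩ := Finset.exists_subset_card_eq (by omega : n + 2 ≤ hfin.toFinset.card)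
  exact hno t (fun x hx => hfin.mem_toFinset.1 (hts hx)) htc
end

section
/- There exists a constant C > 0 such that for every n ≥ 1 there is a set S of n+2 points in ℓ_4^n with (max_{x,y ∈ S} ‖x−y‖_4) / (min_{x,y ∈ S, x≠y} ‖x−y‖_4) ≤ 1 + √(2/n) + C·n^{−3/4}, and moreover this ratio equals 1 + √(2/n) + O(n^{−3/4}) as n → ∞. -/
open Finset

/-- The 4-norm on `ℝ^n`. -/
noncomputable def norm4 {n : ℕ} (x : Fin n → ℝ) : ℝ :=
  (∑ m, (x m) ^ 4) ^ ((1 : ℝ) / 4)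

lemma norm4_nonneg {n : ℕ} (x : Fin n → ℝ) : 0 ≤ norm4 x := by
  unfold norm4; positivity

lemma norm4_pow_four {n : ℕ} (x : Fin n → ℝ) : norm4 x ^ 4 = ∑ m, (x m) ^ 4 := by
  have h : 0 ≤ ∑ m, (x m) ^ 4 := by positivity
  unfold norm4
  rw [← Real.rpow_natCast, ← Real.rpow_mul h]
  norm_num

/-- The two-simplex configuration: the coordinates are split into two blocks by `b`, and every block
carries its basis vectors and a multiple of its all-ones vector, translated by `-c` along that
all-ones vector. -/
def twoSimplices {n : ℕ} (b : Fin n → Bool) (t c : ℝ) : Fin n ⊕ Bool → Fin n → ℝ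
  | .inl i, j => (if j = i then 1 else 0) - (if b j = b i then c else 0)
  | .inr β, j => if b j = β then t - c else 0

section Distances

variable {n : ℕ} (b : Fin n → Bool) (t c : ℝ)

/-- The number of coordinates in a block. -/
def blockSize (β : Bool) : ℝ := #{j | b j = β}

lemma sum_block (β : Bool) (a : ℝ) :
    ∑ j, (if b j = β then a else 0) = blockSize b β * a := by
  rw [← Finset.sum_filter, Finset.sum_const, nsmul_eq_mul, blockSize]

lemma twoSimplices_basis_basis_same {i k : Fin n} (hik : i ≠ k) (h : b i = b k) :
    ∑ j, (twoSimplices b t c (.inl i) j - twoSimplices b t c (.inl k) j) ^ 4 = 2 := by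
  have : ∀ j, (twoSimplices b t c (.inl i) j - twoSimplices b t c (.inl k) j) ^ 4 =
      (if j = i then 1 else 0) + (if j = k then 1 else 0) := by
    intro j
    simp only [twoSimplices, h]
    split_ifs <;> first | (exfalso; simp_all; done) | ring
  simp only [this, Finset.sum_add_distrib, Finset.sum_ite_eq', Finset.mem_univ, if_true]
  norm_num

lemma twoSimplices_basis_basis_ne {i k : Fin n} (h : b i ≠ b k) :
    ∑ j, (twoSimplices b t c (.inl i) j - twoSimplices b t c (.inl k) j) ^ 4 =
      ((1 - c) ^ 4 - c ^ 4 + blockSize b (b i) * c ^ 4) +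
      ((1 - c) ^ 4 - c ^ 4 + blockSize b (b k) * c ^ 4) := by
  have : ∀ j, (twoSimplices b t c (.inl i) j - twoSimplices b t c (.inl k) j) ^ 4 =
      ((if j = i then (1 - c) ^ 4 - c ^ 4 else 0) + (if b j = b i then c ^ 4 else 0)) +
      ((if j = k then (1 - c) ^ 4 - c ^ 4 else 0) + (if b j = b k then c ^ 4 else 0)) := by
    intro j
    simp only [twoSimplices]
    split_ifs <;> first | (exfalso; simp_all; done) | ring
  simp only [this, Finset.sum_add_distrib, Finset.sum_ite_eq', Finset.mem_univ, if_true, sum_block]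

lemma twoSimplices_basis_ones_same (i : Fin n) :
    ∑ j, (twoSimplices b t c (.inl i) j - twoSimplices b t c (.inr (b i)) j) ^ 4 =
      (1 - t) ^ 4 - t ^ 4 + blockSize b (b i) * t ^ 4 := by
  have : ∀ j, (twoSimplices b t c (.inl i) j - twoSimplices b t c (.inr (b i)) j) ^ 4 =
      (if j = i then (1 - t) ^ 4 - t ^ 4 else 0) + (if b j = b i then t ^ 4 else 0) := by
    intro j
    simp only [twoSimplices]
    split_ifs <;> first | (exfalso; simp_all; done) | ring
  simp only [this, Finset.sum_add_distrib, Finset.sum_ite_eq', Finset.mem_univ, if_true, sum_block]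

lemma twoSimplices_basis_ones_ne {i : Fin n} {β : Bool} (h : b i ≠ β) :
    ∑ j, (twoSimplices b t c (.inl i) j - twoSimplices b t c (.inr β) j) ^ 4 =
      ((1 - c) ^ 4 - c ^ 4 + blockSize b (b i) * c ^ 4) + blockSize b β * (t - c) ^ 4 := by
  have : ∀ j, (twoSimplices b t c (.inl i) j - twoSimplices b t c (.inr β) j) ^ 4 =
      ((if j = i then (1 - c) ^ 4 - c ^ 4 else 0) + (if b j = b i then c ^ 4 else 0)) +
      (if b j = β then (t - c) ^ 4 else 0) := by
    intro j
    simp only [twoSimplices]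
    split_ifs <;> first | (exfalso; simp_all; done) | ring
  simp only [this, Finset.sum_add_distrib, Finset.sum_ite_eq', Finset.mem_univ, if_true, sum_block]

lemma twoSimplices_ones_ones {β γ : Bool} (h : β ≠ γ) :
    ∑ j, (twoSimplices b t c (.inr β) j - twoSimplices b t c (.inr γ) j) ^ 4 =
      blockSize b β * (t - c) ^ 4 + blockSize b γ * (t - c) ^ 4 := by
  have : ∀ j, (twoSimplices b t c (.inr β) j - twoSimplices b t c (.inr γ) j) ^ 4 =
      (if b j = β then (t - c) ^ 4 else 0) + (if b j = γ then (t - c) ^ 4 else 0) := by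
    intro j
    simp only [twoSimplices]
    split_ifs <;> first | (exfalso; simp_all; done) | ring
  simp only [this, Finset.sum_add_distrib, sum_block]

lemma sum_sub_pow_four_comm {ι : Type*} (s : Finset ι) (x y : ι → ℝ) :
    ∑ j ∈ s, (x j - y j) ^ 4 = ∑ j ∈ s, (y j - x j) ^ 4 :=
  Finset.sum_congr rfl fun j _ => by ring

/-- Distances between distinct points of the configuration, given that the three types of
quantities are under control. -/
lemma twoSimplices_dist_bounds {η w : ℝ} (hη : 0 ≤ η) (hw : 0 ≤ w)
    (hB : ∀ β, |(1 - t) ^ 4 - t ^ 4 + blockSize b β * t ^ 4 - 2| ≤ 2 * η)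
    (hE : ∀ β, |(1 - c) ^ 4 - c ^ 4 + blockSize b β * c ^ 4 - (1 - w)| ≤ η)
    (hT : ∀ β, |blockSize b β * (t - c) ^ 4 - (1 - w)| ≤ η)
    {p q : Fin n ⊕ Bool} (hpq : p ≠ q) :
    2 - 2 * w - 2 * η ≤ ∑ j, (twoSimplices b t c p j - twoSimplices b t c q j) ^ 4 ∧
      ∑ j, (twoSimplices b t c p j - twoSimplices b t c q j) ^ 4 ≤ 2 + 2 * η := by
  simp only [abs_le] at hB hE hT
  have basis_ones : ∀ (i : Fin n) (β : Bool),
      2 - 2 * w - 2 * η ≤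
          ∑ j, (twoSimplices b t c (.inl i) j - twoSimplices b t c (.inr β) j) ^ 4 ∧
        ∑ j, (twoSimplices b t c (.inl i) j - twoSimplices b t c (.inr β) j) ^ 4 ≤ 2 + 2 * η := by
    intro i β
    by_cases h : b i = β
    · subst h
      rw [twoSimplices_basis_ones_same]
      have := hB (b i)
      constructor <;> linarith
    · rw [twoSimplices_basis_ones_ne b t c h]
      have h₁ := hE (b i)
      have h₂ := hT β
      constructor <;> linarith
  rcases p with i | β <;> rcases q with k | γ
  · have hik : i ≠ k := fun h => hpq (by rw [h])
    by_cases h : b i = b k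
    · rw [twoSimplices_basis_basis_same b t c hik h]
      constructor <;> linarith
    · rw [twoSimplices_basis_basis_ne b t c h]
      have h₁ := hE (b i)
      have h₂ := hE (b k)
      constructor <;> linarith
  · exact basis_ones i γ
  · rw [sum_sub_pow_four_comm]
    exact basis_ones k β
  · have h : β ≠ γ := fun h => hpq (by rw [h])
    rw [twoSimplices_ones_ones b t c h]
    have h₁ := hT β
    have h₂ := hT γ
    constructor <;> linarith

end Distances

lemma exists_bound_of_continuous (q : ℝ × ℝ → ℝ) (hq : Continuous q) :
    ∃ K : ℝ, ∀ s δ : ℝ, 0 ≤ s → s ≤ 1 → |δ| ≤ 1 → |q (s, δ)| ≤ K := by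
  obtain ⟨K, hK⟩ := (isCompact_Icc (a := ((0 : ℝ), (-1 : ℝ))) (b := ((1 : ℝ), (1 : ℝ)))
    ).exists_bound_of_continuousOn hq.continuousOn
  refine ⟨K, fun s δ h0 h1 hδ => hK (s, δ) ?_⟩
  rw [abs_le] at hδ
  exact ⟨⟨h0, hδ.1⟩, ⟨h1, hδ.2⟩⟩

/-- Expansion of the three types of fourth powers of distances in terms of `s = m ^ (-1/4)`. -/
lemma exists_expansion_bound : ∃ K : ℝ, 1 ≤ K ∧ ∀ s m : ℝ, 0 < s → s ≤ 1 → |m * s ^ 4 - 1| ≤ s ^ 4 →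
    |(1 - (s + s ^ 2 - 2 * s ^ 3)) ^ 4 - (s + s ^ 2 - 2 * s ^ 3) ^ 4 +
        m * (s + s ^ 2 - 2 * s ^ 3) ^ 4 - 2| ≤ 2 * (K * s ^ 3) ∧
    |(1 - (s ^ 2 - s ^ 3)) ^ 4 - (s ^ 2 - s ^ 3) ^ 4 + m * (s ^ 2 - s ^ 3) ^ 4 - (1 - 4 * s ^ 2)|
      ≤ K * s ^ 3 ∧
    |m * ((s + s ^ 2 - 2 * s ^ 3) - (s ^ 2 - s ^ 3)) ^ 4 - (1 - 4 * s ^ 2)| ≤ K * s ^ 3 := by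
  obtain ⟨K₁, h₁⟩ := exists_bound_of_continuous (fun z =>
      -4 - 29 * z.1 + z.1 * z.2 + 28 * z.1 ^ 2 + 4 * z.1 ^ 2 * z.2 + 60 * z.1 ^ 3 - 2 * z.1 ^
      3 * z.2 - 56 * z.1 ^ 4 - 20 * z.1 ^ 4 * z.2 - 32 * z.1 ^ 5 + z.1 ^ 5 * z.2 + 32 * z.1 ^
      6 + 40 * z.1 ^ 6 * z.2 - 8 * z.1 ^ 7 * z.2 - 32 * z.1 ^ 8 * z.2 + 16 * z.1 ^ 9 * z.2) (by fun_prop)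
  obtain ⟨K₂, h₂⟩ := exists_bound_of_continuous (fun z =>
      4 + 7 * z.1 - 16 * z.1 ^ 2 + 8 * z.1 ^ 3 + 8 * z.1 ^ 4 - 11 * z.1 ^ 5 + z.1 ^ 5 * z.2 +
      4 * z.1 ^ 6 - 4 * z.1 ^ 6 * z.2 + 6 * z.1 ^ 7 * z.2 - 4 * z.1 ^ 8 * z.2 + z.1 ^ 9 * z.2) (by fun_prop)
  obtain ⟨K₃, h₃⟩ := exists_bound_of_continuous (fun z =>
      6 * z.1 + z.1 * z.2 - 4 * z.1 ^ 3 - 4 * z.1 ^ 3 * z.2 + z.1 ^ 5 + 6 * z.1 ^ 5 * z.2 - 4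
      * z.1 ^ 7 * z.2 + z.1 ^ 9 * z.2) (by fun_prop)
  refine ⟨max 1 (max K₁ (max K₂ K₃)), le_max_left _ _, fun s m hs hs1 hm => ?_⟩
  set K := max 1 (max K₁ (max K₂ K₃))
  have hK₁ : K₁ ≤ K := (le_max_left _ _).trans (le_max_right _ _)
  have hK₂ : K₂ ≤ K := (le_max_left _ _).trans ((le_max_right _ _).trans (le_max_right _ _))
  have hK₃ : K₃ ≤ K := (le_max_right _ _).trans ((le_max_right _ _).trans (le_max_right _ _))
  have hK : 1 ≤ K := le_max_left _ _
  obtain ⟨δ, hδ, rfl⟩ : ∃ δ : ℝ, |δ| ≤ 1 ∧ m = (1 + δ * s ^ 4) / s ^ 4 := by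
    refine ⟨(m * s ^ 4 - 1) / s ^ 4, ?_, by field_simp; ring⟩
    rw [abs_div, abs_of_pos (by positivity : 0 < s ^ 4)]
    exact div_le_one_of_le₀ hm (by positivity)
  have key : ∀ {x L q : ℝ}, x = s ^ 3 * q → |q| ≤ L → L ≤ K → |x| ≤ K * s ^ 3 := by
    intro x L q hx hq hL
    rw [hx, abs_mul, abs_of_pos (by positivity : 0 < s ^ 3), mul_comm]
    gcongr
    exact hq.trans hL
  refine ⟨?_, key ?_ (h₂ s δ hs.le hs1 hδ) hK₂, key ?_ (h₃ s δ hs.le hs1 hδ) hK₃⟩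
  · refine (key ?_ (h₁ s δ hs.le hs1 hδ) hK₁).trans ?_
    · field_simp
      ring
    · have : 0 ≤ K * s ^ 3 := by positivity
      linarith
  · field_simp
    ring
  · field_simp
    ring

lemma ratio_estimate {K s M μ : ℝ} (hK : 1 ≤ K) (hs : 0 < s) (hsK : 100 * K * s ≤ 1)
    (hM : 0 ≤ M) (hμ : 0 ≤ μ)
    (hM₁ : 2 - 2 * (K * s ^ 3) ≤ M ^ 4) (hM₂ : M ^ 4 ≤ 2 + 2 * (K * s ^ 3))
    (hμ₁ : 2 - 2 * (4 * s ^ 2) - 2 * (K * s ^ 3) ≤ μ ^ 4)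
    (hμ₂ : μ ^ 4 ≤ 2 - 2 * (4 * s ^ 2) + 2 * (K * s ^ 3)) :
    |M / μ - (1 + s ^ 2)| ≤ 9 * K * s ^ 3 := by
  have hs100 : s ≤ 1 / 100 := by nlinarith
  have hs2 : s ^ 2 ≤ s / 100 := by nlinarith
  have hKs2 : K * s ^ 2 ≤ s / 100 := by nlinarith
  have hKs3 : K * s ^ 3 ≤ s ^ 2 / 100 := by nlinarith [sq_nonneg s]
  have h3 : 0 < s ^ 3 := by positivity
  have hs4K : s ^ 4 ≤ K * s ^ 3 / 100 := by nlinarith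
  have hKs3' : 0 < K * s ^ 3 := by positivity
  set w := s ^ 2 with hw
  set v := K * s ^ 3 with hv
  have hw0 : 0 < w := by positivity
  have hw4 : w ^ 2 ≤ v / 100 := by rw [hw]; linarith [hs4K, (by ring : (s ^ 2) ^ 2 = s ^ 4)]
  have hw_small : w ≤ 1 / 10000 := by nlinarith
  have hμ4 : 0 < μ ^ 4 := by nlinarith
  have hμ_pos : 0 < μ := by
    rcases hμ.lt_or_eq with h | h
    · exact h
    · rw [← h] at hμ4; norm_num at hμ4
  have hg : 9 * K * s ^ 3 = 9 * v := by rw [hv]; ring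
  rw [hg, abs_sub_le_iff]
  constructor
  · suffices M / μ ≤ 1 + w + 9 * v by linarith
    rw [div_le_iff₀ hμ_pos]
    refine le_of_pow_le_pow_left₀ (n := 4) (by norm_num) (by positivity) ?_
    rw [mul_pow]
    have hb : 1 + 4 * (w + 9 * v) ≤ (1 + w + 9 * v) ^ 4 := by
      have := one_add_mul_le_pow (a := w + 9 * v) (by linarith) 4
      push_cast at this
      rw [← add_assoc] at this
      linarith
    calc M ^ 4 ≤ 2 + 2 * v := hM₂
      _ ≤ (1 + 4 * (w + 9 * v)) * (2 - 2 * (4 * w) - 2 * v) := by nlinarith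
      _ ≤ (1 + w + 9 * v) ^ 4 * μ ^ 4 := by
        apply mul_le_mul hb hμ₁ (by linarith) (by positivity)
  · suffices 1 + w - 9 * v ≤ M / μ by linarith
    rw [le_div_iff₀ hμ_pos]
    refine le_of_pow_le_pow_left₀ (n := 4) (by norm_num) hM ?_
    rw [mul_pow]
    have hb : (1 + w - 9 * v) ^ 4 ≤ 1 + 4 * (w - 9 * v) + 11 * w ^ 2 := by
      obtain ⟨y, hy⟩ : ∃ y, y = w - 9 * v := ⟨_, rfl⟩
      have hy0 : 0 ≤ y := by linarith
      have hyw : y ≤ w := by linarith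
      have hy2 : y ^ 2 ≤ w ^ 2 := by gcongr
      have hy1 : y ≤ 1 := by linarith
      have hy3 : y ^ 3 ≤ y ^ 2 := pow_le_pow_of_le_one hy0 hy1 (by norm_num)
      have hy4 : y ^ 4 ≤ y ^ 2 := pow_le_pow_of_le_one hy0 hy1 (by norm_num)
      rw [add_sub_assoc, ← hy]
      nlinarith
    calc (1 + w - 9 * v) ^ 4 * μ ^ 4
        ≤ (1 + 4 * (w - 9 * v) + 11 * w ^ 2) * (2 - 2 * (4 * w) + 2 * v) := by
          apply mul_le_mul hb hμ₂ hμ4.le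
          nlinarith
      _ ≤ 2 - 2 * v := by nlinarith [mul_pos hw0 hKs3', sq_nonneg w, mul_pos hKs3' hKs3']
      _ ≤ M ^ 4 := hM₁

lemma exists_finset_extremal_norm4_bounds {n : ℕ} {ι : Type*} [Fintype ι] (P : ι → Fin n → ℝ)
    {lo lo' hi hi' : ℝ} (hlo : 0 < lo)
    (hP : ∀ p q, p ≠ q → lo ≤ ∑ j, (P p j - P q j) ^ 4 ∧ ∑ j, (P p j - P q j) ^ 4 ≤ hi)
    {p₀ q₀ p₁ q₁ : ι} (h₀ : p₀ ≠ q₀) (hlo' : ∑ j, (P p₀ j - P q₀ j) ^ 4 ≤ lo')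
    (hhi' : hi' ≤ ∑ j, (P p₁ j - P q₁ j) ^ 4) :
    ∃ S : Finset (Fin n → ℝ), S.card = Fintype.card ι ∧ ∃ M μ : ℝ, 0 ≤ M ∧ 0 ≤ μ ∧
      M = sSup {d : ℝ | ∃ x ∈ S, ∃ y ∈ S, d = norm4 (x - y)} ∧
      μ = sInf {d : ℝ | ∃ x ∈ S, ∃ y ∈ S, x ≠ y ∧ d = norm4 (x - y)} ∧
      hi' ≤ M ^ 4 ∧ M ^ 4 ≤ hi ∧ lo ≤ μ ^ 4 ∧ μ ^ 4 ≤ lo' := by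
  classical
  have hinj : Function.Injective P := by
    intro p q hpq
    by_contra hne
    have := (hP p q hne).1
    simp [hpq] at this
    linarith
  have hd : ∀ p q, norm4 (P p - P q) ^ 4 = ∑ j, (P p j - P q j) ^ 4 := fun p q => by
    rw [norm4_pow_four]; rfl
  have hhi : 0 < hi := hlo.trans_le ((hP _ _ h₀).1.trans (hP _ _ h₀).2)
  have root : ∀ {a : ℝ}, 0 ≤ a → (a ^ ((1 : ℝ) / 4)) ^ 4 = a := fun {a} ha => by
    rw [← Real.rpow_natCast, ← Real.rpow_mul ha]; norm_num
  have hub : ∀ d ∈ {d : ℝ | ∃ x ∈ univ.image P, ∃ y ∈ univ.image P, d = norm4 (x - y)},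
      d ≤ hi ^ ((1 : ℝ) / 4) := by
    simp only [mem_image, mem_univ, true_and, Set.mem_ofPred_eq]
    rintro d ⟨_, ⟨p, rfl⟩, _, ⟨q, rfl⟩, rfl⟩
    refine le_of_pow_le_pow_left₀ (n := 4) (by norm_num) (by positivity) ?_
    rw [hd, root hhi.le]
    by_cases hpq : p = q
    · simpa [hpq] using hhi.le
    · exact (hP p q hpq).2
  have hlb : ∀ d ∈ {d : ℝ | ∃ x ∈ univ.image P, ∃ y ∈ univ.image P, x ≠ y ∧ d = norm4 (x - y)},
      lo ^ ((1 : ℝ) / 4) ≤ d := by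
    simp only [mem_image, mem_univ, true_and, Set.mem_ofPred_eq]
    rintro d ⟨_, ⟨p, rfl⟩, _, ⟨q, rfl⟩, hne, rfl⟩
    refine le_of_pow_le_pow_left₀ (n := 4) (by norm_num) (norm4_nonneg _) ?_
    rw [hd, root hlo.le]
    exact (hP p q fun h => hne (by rw [h])).1
  have hmem₁ : norm4 (P p₁ - P q₁) ∈
      {d : ℝ | ∃ x ∈ univ.image P, ∃ y ∈ univ.image P, d = norm4 (x - y)} :=
    ⟨P p₁, by simp, P q₁, by simp, rfl⟩
  have hmem₀ : norm4 (P p₀ - P q₀) ∈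
      {d : ℝ | ∃ x ∈ univ.image P, ∃ y ∈ univ.image P, x ≠ y ∧ d = norm4 (x - y)} :=
    ⟨P p₀, by simp, P q₀, by simp, hinj.ne h₀, rfl⟩
  have hM := le_csSup ⟨_, hub⟩ hmem₁
  have hM' := csSup_le ⟨_, hmem₁⟩ hub
  have hμ := csInf_le ⟨_, hlb⟩ hmem₀
  have hμ' := le_csInf ⟨_, hmem₀⟩ hlb
  have hM0 := (norm4_nonneg _).trans hM
  have hμ0 : 0 ≤ sInf {d : ℝ | ∃ x ∈ univ.image P, ∃ y ∈ univ.image P, x ≠ y ∧ d = norm4 (x - y)} :=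
    le_trans (by positivity) hμ'
  refine ⟨univ.image P, ?_, _, _, hM0, hμ0, rfl, rfl, ?_, ?_, ?_, ?_⟩
  · rw [Finset.card_image_of_injective _ hinj, Finset.card_univ]
  · exact (hhi'.trans (hd _ _).ge).trans (pow_le_pow_left₀ (norm4_nonneg _) hM 4)
  · exact (pow_le_pow_left₀ hM0 hM' 4).trans (root hhi.le).le
  · exact (root hlo.le).ge.trans (pow_le_pow_left₀ (by positivity) hμ' 4)
  · exact (pow_le_pow_left₀ hμ0 hμ 4).trans ((hd _ _).le.trans hlo')

lemma blockSize_half_bound (n : ℕ) (β : Bool) :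
    |blockSize (fun j : Fin n => decide (j.val < n / 2)) β - n / 2| ≤ 1 / 2 := by
  have hsum : (#{j : Fin n | j.val < n / 2}) = n / 2 := by
    rw [Fin.card_filter_val_lt]; omega
  have hcompl := Finset.card_filter_add_card_filter_not (s := (univ : Finset (Fin n)))
    (fun j : Fin n => j.val < n / 2)
  rw [hsum, Finset.card_univ, Fintype.card_fin] at hcompl
  have h1 : 2 * (n / 2) ≤ n := by omega
  have h2 : n ≤ 2 * (n / 2) + 1 := by omega
  have h1' : 2 * ((n / 2 : ℕ) : ℝ) ≤ n := by exact_mod_cast h1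
  have h2' : (n : ℝ) ≤ 2 * ((n / 2 : ℕ) : ℝ) + 1 := by exact_mod_cast h2
  rw [abs_le]
  cases β
  · simp only [blockSize, decide_eq_false_iff_not]
    have : ((n / 2 : ℕ) : ℝ) + (#{j : Fin n | ¬ j.val < n / 2} : ℝ) = n := by exact_mod_cast hcompl
    constructor <;> linarith
  · simp only [blockSize, decide_eq_true_eq, hsum]
    constructor <;> linarith

lemma exists_ratio_estimate_of_large : ∃ (C : ℝ) (N : ℕ), 0 < C ∧ ∀ n : ℕ, N ≤ n →
    ∃ S : Finset (Fin n → ℝ), S.card = n + 2 ∧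
      |sSup {d : ℝ | ∃ x ∈ S, ∃ y ∈ S, d = norm4 (x - y)} /
          sInf {d : ℝ | ∃ x ∈ S, ∃ y ∈ S, x ≠ y ∧ d = norm4 (x - y)} -
        (1 + Real.sqrt (2 / (n : ℝ)))| ≤ C * (n : ℝ) ^ (-(3 : ℝ) / 4) := by
  obtain ⟨K, hK, hexp⟩ := exists_expansion_bound
  obtain ⟨N, hN⟩ := exists_nat_ge (2 * (100 * K) ^ 4)
  refine ⟨9 * K * 2 ^ ((3 : ℝ) / 4), N + 1, by positivity, fun n hn => ?_⟩
  have hn' : (N : ℝ) + 1 ≤ n := by exact_mod_cast hn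
  have hn0 : (0 : ℝ) < n := by linarith [(Nat.cast_nonneg N : (0 : ℝ) ≤ N)]
  obtain ⟨s, hsdef⟩ : ∃ s : ℝ, s = (2 / (n : ℝ)) ^ ((1 : ℝ) / 4) := ⟨_, rfl⟩
  have hs : 0 < s := by rw [hsdef]; positivity
  have hs4 : s ^ 4 = 2 / n := by
    rw [hsdef, ← Real.rpow_natCast, ← Real.rpow_mul (by positivity)]; norm_num
  have hs2 : s ^ 2 = Real.sqrt (2 / n) := by
    rw [hsdef, ← Real.rpow_natCast, ← Real.rpow_mul (by positivity), Real.sqrt_eq_rpow]; norm_num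
  have hs3 : s ^ 3 = 2 ^ ((3 : ℝ) / 4) * (n : ℝ) ^ (-(3 : ℝ) / 4) := by
    rw [hsdef, ← Real.rpow_natCast, ← Real.rpow_mul (by positivity),
      Real.div_rpow (by norm_num) hn0.le, neg_div, Real.rpow_neg hn0.le, div_eq_mul_inv]
    norm_num
  have hsK : 100 * K * s ≤ 1 := by
    refine le_of_pow_le_pow_left₀ (n := 4) (by norm_num) (by norm_num) ?_
    rw [mul_pow, hs4, one_pow, mul_div_assoc', div_le_one hn0]
    linarith
  have hs1 : 100 * s ≤ 1 := by nlinarith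
  set b := fun j : Fin n => decide (j.val < n / 2)
  have hm : ∀ β, |blockSize b β * s ^ 4 - 1| ≤ s ^ 4 := by
    intro β
    have h := blockSize_half_bound n β
    have : blockSize b β * s ^ 4 - 1 = (blockSize b β - n / 2) * s ^ 4 := by
      rw [hs4]; field_simp
    rw [this, abs_mul, abs_of_pos (by positivity : 0 < s ^ 4)]
    have : 0 < s ^ 4 := by positivity
    nlinarith
  have hexp' := fun β => hexp s (blockSize b β) hs (by linarith) (hm β)
  have hη : 0 ≤ K * s ^ 3 := by positivity
  have hKs3 : 100 * (K * s ^ 3) ≤ s ^ 2 := by nlinarith [sq_nonneg s]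
  have i₀ : Fin n := ⟨0, by exact_mod_cast hn0⟩
  obtain ⟨S, hS, M, μ, hM0, hμ0, rfl, rfl, hM₁, hM₂, hμ₁, hμ₂⟩ :=
    exists_finset_extremal_norm4_bounds (twoSimplices b (s + s ^ 2 - 2 * s ^ 3) (s ^ 2 - s ^ 3))
      (lo := 2 - 2 * (4 * s ^ 2) - 2 * (K * s ^ 3)) (lo' := 2 - 2 * (4 * s ^ 2) + 2 * (K * s ^ 3))
      (hi := 2 + 2 * (K * s ^ 3)) (hi' := 2 - 2 * (K * s ^ 3))
      (p₀ := .inr true) (q₀ := .inr false) (p₁ := .inl i₀) (q₁ := .inr (b i₀))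
      (by nlinarith)
      (fun p q hpq => twoSimplices_dist_bounds b _ _ hη (by positivity) (fun β => (hexp' β).1)
        (fun β => (hexp' β).2.1) (fun β => (hexp' β).2.2) hpq)
      (by simp)
      (by
        rw [twoSimplices_ones_ones b _ _ (by simp)]
        have h₁ := (abs_le.1 (hexp' true).2.2).2
        have h₂ := (abs_le.1 (hexp' false).2.2).2
        linarith)
      (by
        rw [twoSimplices_basis_ones_same]
        linarith [(abs_le.1 (hexp' (b i₀)).1).1])
  refine ⟨S, by simpa using hS, ?_⟩
  rw [← hs2, mul_assoc, ← hs3]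
  exact ratio_estimate hK hs hsK hM0 hμ0 hM₁ hM₂ hμ₁ hμ₂

/-- **Proposition (construction).** There is a constant `C > 0` such that for every
`n ≥ 1` there is a set `S` of `n+2` points in `ℓ₄ⁿ` whose ratio of maximum to minimum
distance is `1 + √(2/n) + O(n^{-3/4})`; in particular the ratio differs from
`1 + √(2/n)` by at most `C · n^{-3/4}`. -/
theorem stmt2 : ∃ C : ℝ, 0 < C ∧ ∀ n : ℕ, 1 ≤ n →
    ∃ S : Finset (Fin n → ℝ), S.card = n + 2 ∧
      |sSup {d : ℝ | ∃ x ∈ S, ∃ y ∈ S, d = norm4 (x - y)} /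
          sInf {d : ℝ | ∃ x ∈ S, ∃ y ∈ S, x ≠ y ∧ d = norm4 (x - y)} -
        (1 + Real.sqrt (2 / (n : ℝ)))| ≤ C * (n : ℝ) ^ (-(3 : ℝ) / 4) := by
  obtain ⟨C, N, hC, hlarge⟩ := exists_ratio_estimate_of_large
  have hsmall : ∀ n : ℕ, ∃ D : ℝ, 0 ≤ D ∧ (1 ≤ n →
      ∃ S : Finset (Fin n → ℝ), S.card = n + 2 ∧
      |sSup {d : ℝ | ∃ x ∈ S, ∃ y ∈ S, d = norm4 (x - y)} /
          sInf {d : ℝ | ∃ x ∈ S, ∃ y ∈ S, x ≠ y ∧ d = norm4 (x - y)} -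
        (1 + Real.sqrt (2 / (n : ℝ)))| ≤ D * (n : ℝ) ^ (-(3 : ℝ) / 4)) := by
    intro n
    rcases Nat.eq_zero_or_pos n with rfl | hn
    · exact ⟨0, le_rfl, fun h => absurd h (by norm_num)⟩
    have : Nonempty (Fin n) := ⟨⟨0, hn⟩⟩
    obtain ⟨S, hS⟩ := Infinite.exists_subset_card_eq (Fin n → ℝ) (n + 2)
    have hpos : 0 < (n : ℝ) ^ (-(3 : ℝ) / 4) := by
      have : (0 : ℝ) < n := by exact_mod_cast hn
      positivity
    exact ⟨_, by positivity, fun _ => ⟨S, hS, (div_mul_cancel₀ _ hpos.ne').ge⟩⟩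
  choose D hD0 hD using hsmall
  have hsum : 0 ≤ ∑ k ∈ range N, D k := Finset.sum_nonneg fun k _ => hD0 k
  refine ⟨C + ∑ k ∈ range N, D k, by linarith, fun n hn => ?_⟩
  have hpos : 0 ≤ (n : ℝ) ^ (-(3 : ℝ) / 4) := by positivity
  rcases le_or_gt N n with h | h
  · obtain ⟨S, hS, hle⟩ := hlarge n h
    exact ⟨S, hS, hle.trans (mul_le_mul_of_nonneg_right (by linarith) hpos)⟩
  · obtain ⟨S, hS, hle⟩ := hD n hn
    refine ⟨S, hS, hle.trans (mul_le_mul_of_nonneg_right ?_ hpos)⟩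
    have := Finset.single_le_sum (fun k _ => hD0 k) (Finset.mem_range.2 h)
    linarith
end
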